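/- Let n, L be positive integers, α ∈ (0,2), σ > 0, ν > 0, let q_1,…,q_L be nonnegative reals, let τ_1,…,τ_L be vectors in ℝ^n with entries in {−1,+1}, and let μ be a probability measure on [0,∞) whose Laplace transform satisfies ∫_0^∞ exp(−λ t) dμ(t) = exp(−λ^{α/2}) for all λ ≥ 0. For s ∈ (0,∞)^L set Q(s) = σ²·I + ν Σ_{ℓ=1}^L s_ℓ q_ℓ^{2/α} τ_ℓ τ_ℓᵀ and define p(y) = (2π)^{−n/2} ∫_{(0,∞)^L} exp(−(1/2) yᵀQ(s)⁻¹y) · det(Q(s))^{−1/2} dμ^{⊗L}(s). Then for every t ∈ ℝ^n, ∫_{ℝ^n} p(y) exp(i⟨t,y⟩) dy = exp(−(1/2)σ²‖t‖² − (ν/2)^{α/2} Σ_{ℓ=1}^L q_ℓ |⟨t, τ_ℓ⟩|^α). -/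

import Mathlib

open Matrix MeasureTheory Real

namespace Matrix

open scoped MatrixOrder Matrix.Norms.L2Operator in
lemma PosDef.exists_mul_transpose {n : Type*} [Fintype n] [DecidableEq n] {A : Matrix n n ℝ}
    (hA : A.PosDef) : ∃ S : Matrix n n ℝ, A = S * Sᵀ ∧ S.det ≠ 0 := by
  obtain ⟨B, hB⟩ := CStarAlgebra.nonneg_iff_eq_star_mul_self.mp hA.posSemidef.nonneg
  rw [star_eq_conjTranspose, conjTranspose_eq_transpose_of_trivial] at hB
  refine ⟨Bᵀ, by rw [transpose_transpose, hB], fun h => hA.det_pos.ne' ?_⟩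
  rw [hB, det_mul, h, zero_mul]

end Matrix

lemma integral_stdGaussian_mul_cexp {n : ℕ} (c : Fin n → ℝ) :
    ∫ x : Fin n → ℝ, ((rexp (-(1 / 2) * (x ⬝ᵥ x)) : ℝ) : ℂ) *
        Complex.exp (Complex.I * ((c ⬝ᵥ x : ℝ) : ℂ)) =
      (((2 * π) ^ ((n : ℝ) / 2) * rexp (-(1 / 2) * (c ⬝ᵥ c)) : ℝ) : ℂ) := by
  have h := GaussianFourier.integral_cexp_neg_mul_sum_add (b := (1 / 2 : ℂ)) (by norm_num)
    (fun i => Complex.I * (c i : ℂ))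
  have hconst : ((π : ℂ) / (1 / 2)) ^ ((n : ℂ) / 2) = (((2 * π) ^ ((n : ℝ) / 2) : ℝ) : ℂ) := by
    rw [Complex.ofReal_cpow (by positivity)]
    push_cast
    congr 1
    ring
  rw [Fintype.card_fin, hconst] at h
  push_cast [dotProduct] at h ⊢
  convert! h using 2
  · ext x
    rw [← Complex.exp_add]
    simp only [pow_two, Finset.mul_sum, neg_mul, mul_assoc]
  · congr 1
    simp only [mul_pow, Complex.I_sq, Finset.mul_sum, Finset.sum_div]
    refine Finset.sum_congr rfl fun i _ => ?_
    ring

lemma integral_comp_mulVec {ι : Type*} [Fintype ι] [DecidableEq ι] {S : Matrix ι ι ℝ}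
    (hS : S.det ≠ 0) {f : (ι → ℝ) → ℂ} (hf : Continuous f) :
    ∫ y, f y = (|S.det| : ℝ) * ∫ x, f (S *ᵥ x) := by
  have hm : AEMeasurable (toLin' S) (volume : Measure (ι → ℝ)) :=
    (LinearMap.continuous_of_finiteDimensional _).measurable.aemeasurable
  have h := integral_map hm (hf.aestronglyMeasurable (μ := volume.map (toLin' S)))
  rw [Real.map_matrix_volume_pi_eq_smul_volume_pi hS, integral_smul_measure,
    ENNReal.toReal_ofReal (abs_nonneg _)] at h
  simp only [toLin'_apply] at h
  rw [← h, Complex.real_smul, ← mul_assoc, ← Complex.ofReal_mul, ← abs_mul, mul_inv_cancel₀ hS]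
  simp

namespace Matrix.PosDef

variable {n : ℕ} {A : Matrix (Fin n) (Fin n) ℝ}

lemma integral_gaussian_mul_cexp (hA : A.PosDef) (t : Fin n → ℝ) :
    ∫ y : Fin n → ℝ, ((rexp (-(1 / 2) * (y ⬝ᵥ A⁻¹ *ᵥ y)) : ℝ) : ℂ) *
        Complex.exp (Complex.I * ((t ⬝ᵥ y : ℝ) : ℂ)) =
      (((2 * π) ^ ((n : ℝ) / 2) * A.det ^ (1 / 2 : ℝ) *
        rexp (-(1 / 2) * (t ⬝ᵥ A *ᵥ t)) : ℝ) : ℂ) := by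
  obtain ⟨S, rfl, hS⟩ := hA.exists_mul_transpose
  have hU : IsUnit S.det := hS.isUnit
  have hU' : IsUnit Sᵀ.det := by rwa [det_transpose]
  rw [integral_comp_mulVec hS (by fun_prop)]
  have hquad (x : Fin n → ℝ) : S *ᵥ x ⬝ᵥ (S * Sᵀ)⁻¹ *ᵥ S *ᵥ x = x ⬝ᵥ x := by
    rw [mulVec_mulVec, Matrix.mul_inv_rev, Matrix.mul_assoc, Matrix.nonsing_inv_mul _ hU,
      Matrix.mul_one, dotProduct_comm, dotProduct_mulVec, ← mulVec_transpose, mulVec_mulVec,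
      Matrix.mul_nonsing_inv _ hU', one_mulVec]
  have hlin (x : Fin n → ℝ) : t ⬝ᵥ S *ᵥ x = (Sᵀ *ᵥ t) ⬝ᵥ x := by
    rw [dotProduct_mulVec, mulVec_transpose]
  simp_rw [hquad, hlin]
  rw [integral_stdGaussian_mul_cexp, ← Complex.ofReal_mul, det_mul, det_transpose,
    ← Real.sqrt_eq_rpow, Real.sqrt_mul_self_eq_abs, ← mulVec_mulVec, hlin]
  congr 1
  ring

lemma integral_gaussian (hA : A.PosDef) :
    ∫ y : Fin n → ℝ, rexp (-(1 / 2) * (y ⬝ᵥ A⁻¹ *ᵥ y)) =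
      (2 * π) ^ ((n : ℝ) / 2) * A.det ^ (1 / 2 : ℝ) := by
  have h := hA.integral_gaussian_mul_cexp 0
  simp only [zero_dotProduct, Complex.ofReal_zero, mul_zero, Complex.exp_zero, mul_one,
    Real.exp_zero, integral_complex_ofReal] at h
  exact_mod_cast h

lemma integrable_gaussian (hA : A.PosDef) :
    Integrable fun y : Fin n → ℝ => rexp (-(1 / 2) * (y ⬝ᵥ A⁻¹ *ᵥ y)) := by
  by_contra h
  have hdet := hA.det_pos
  have := hA.integral_gaussian
  rw [integral_undef h] at this
  exact absurd this (by positivity)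

end Matrix.PosDef

/-- A measure on `[0, ∞)` with Laplace transform `exp (-l ^ a)`, `a > 0`, has no atom at `0`. -/
lemma ae_pos_of_laplace_eq_exp_neg_rpow {μ : Measure ℝ} [IsProbabilityMeasure μ] {a : ℝ}
    (ha : 0 < a) (hsupp : μ (Set.Iio 0) = 0)
    (hLap : ∀ l : ℝ, 0 ≤ l → ∫ t, rexp (-l * t) ∂μ = rexp (-l ^ a)) :
    ∀ᵐ t ∂μ, 0 < t := by
  have hle (l : ℝ) (hl : 0 ≤ l) : μ.real {0} ≤ rexp (-l ^ a) := by
    rw [← hLap l hl, ← integral_indicator_one (measurableSet_singleton (0 : ℝ))]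
    refine integral_mono ((integrable_const (1 : ℝ)).indicator (measurableSet_singleton _)) ?_ ?_
    · by_contra h
      have := hLap l hl
      rw [integral_undef h] at this
      exact (Real.exp_pos _).ne this
    · intro t
      by_cases ht : t = 0
      · simp [ht]
      · simp [ht, (Real.exp_pos _).le]
  have hlim : Filter.Tendsto (fun l : ℝ => rexp (-l ^ a)) Filter.atTop (nhds 0) :=
    Real.tendsto_exp_neg_atTop_nhds_zero.comp (tendsto_rpow_atTop ha)
  have h0 : μ.real {0} = 0 := le_antisymm
    (ge_of_tendsto hlim ((Filter.eventually_ge_atTop 0).mono hle)) measureReal_nonneg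
  rw [measureReal_eq_zero_iff] at h0
  have hIic : μ (Set.Iic 0) = 0 := by
    rw [← Set.Iio_union_right]
    exact measure_union_null hsupp h0
  filter_upwards [measure_eq_zero_iff_ae_notMem.mp hIic] with t ht
  simpa using ht

section Mixture

variable {ι : Type*} [Fintype ι] {n : ℕ}

lemma posDef_smul_one_add_sum_rankOne {σ ν : ℝ} (hσ : 0 < σ) (hν : 0 < ν) {w : ι → ℝ}
    (hw : ∀ ℓ, 0 ≤ w ℓ) (τ : ι → Fin n → ℝ) :
    (σ ^ 2 • (1 : Matrix (Fin n) (Fin n) ℝ) +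
      ν • ∑ ℓ, w ℓ • Matrix.of (fun i j : Fin n => τ ℓ i * τ ℓ j)).PosDef := by
  refine (PosDef.one.smul (by positivity)).add_posSemidef
    ((posSemidef_sum _ fun ℓ _ => PosSemidef.smul ?_ (hw ℓ)).smul hν.le)
  simpa [vecMulVec, Function.comp_def] using posSemidef_vecMulVec_self_star (τ ℓ)

lemma dotProduct_smul_one_add_sum_rankOne_mulVec (σ ν : ℝ) (w : ι → ℝ) (τ : ι → Fin n → ℝ)
    (t : Fin n → ℝ) :
    t ⬝ᵥ (σ ^ 2 • (1 : Matrix (Fin n) (Fin n) ℝ) +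
      ν • ∑ ℓ, w ℓ • Matrix.of (fun i j : Fin n => τ ℓ i * τ ℓ j)) *ᵥ t =
      σ ^ 2 * ∑ j, t j ^ 2 + ν * ∑ ℓ, w ℓ * (∑ j, t j * τ ℓ j) ^ 2 := by
  have h (ℓ : ι) : t ⬝ᵥ Matrix.of (fun i j : Fin n => τ ℓ i * τ ℓ j) *ᵥ t =
      (∑ j, t j * τ ℓ j) ^ 2 := by
    have : Matrix.of (fun i j : Fin n => τ ℓ i * τ ℓ j) = vecMulVec (τ ℓ) (τ ℓ) := rfl
    rw [this, vecMulVec_mulVec, dotProduct_smul, dotProduct_comm (τ ℓ) t, pow_two]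
    simp [dotProduct]
  simp only [add_mulVec, smul_mulVec, sum_mulVec, one_mulVec, dotProduct_add, dotProduct_smul,
    dotProduct_sum, h, smul_eq_mul]
  simp [dotProduct, pow_two]

lemma measurable_matrix_det {Ω m : Type*} [MeasurableSpace Ω] [Fintype m] [DecidableEq m]
    {Q : Ω → Matrix m m ℝ} (hQ : ∀ i j, Measurable fun s => Q s i j) :
    Measurable fun s => (Q s).det := by
  simp only [det_apply]
  fun_prop

lemma measurable_matrix_inv_apply {Ω m : Type*} [MeasurableSpace Ω] [Fintype m] [DecidableEq m]
    {Q : Ω → Matrix m m ℝ} (hQ : ∀ i j, Measurable fun s => Q s i j) (i j : m) :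
    Measurable fun s => (Q s)⁻¹ i j := by
  have hadj : Measurable fun s => (Q s).adjugate i j := by
    simp only [adjugate_apply]
    refine measurable_matrix_det fun k l => ?_
    by_cases hk : k = j <;> simp [updateRow_apply, hk, hQ]
  simp only [Matrix.inv_def, Ring.inverse_eq_inv', Matrix.smul_apply, smul_eq_mul]
  exact (measurable_matrix_det hQ).inv.mul hadj

/-- The characteristic function of a scale mixture of centred Gaussians is the mixture of their
characteristic functions. -/
lemma integral_gaussianMixture_mul_cexp {Ω : Type*} [MeasurableSpace Ω] {P : Measure Ω}
    [IsFiniteMeasure P] {Q : Ω → Matrix (Fin n) (Fin n) ℝ}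
    (hQm : ∀ i j, Measurable fun s => Q s i j) (hQ : ∀ᵐ s ∂P, (Q s).PosDef) (t : Fin n → ℝ) :
    ∫ y : Fin n → ℝ, (((2 * π) ^ (-(n : ℝ) / 2) *
        ∫ s, rexp (-(1 / 2) * (y ⬝ᵥ (Q s)⁻¹ *ᵥ y)) * (Q s).det ^ (-(1 / 2) : ℝ) ∂P : ℝ) : ℂ) *
          Complex.exp (Complex.I * ((t ⬝ᵥ y : ℝ) : ℂ)) =
      ((∫ s, rexp (-(1 / 2) * (t ⬝ᵥ Q s *ᵥ t)) ∂P : ℝ) : ℂ) := by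
  have hdet := measurable_matrix_det hQm
  have hinv := measurable_matrix_inv_apply hQm
  set F : (Fin n → ℝ) → Ω → ℝ := fun y s =>
    rexp (-(1 / 2) * (y ⬝ᵥ (Q s)⁻¹ *ᵥ y)) * (Q s).det ^ (-(1 / 2) : ℝ) with hF
  have hFm : Measurable (Function.uncurry F) := by
    have hquad : Measurable fun z : (Fin n → ℝ) × Ω => z.1 ⬝ᵥ (Q z.2)⁻¹ *ᵥ z.1 := by
      simp only [dotProduct, mulVec]
      refine Finset.measurable_sum _ fun i _ => ?_
      refine ((measurable_pi_apply i).comp measurable_fst).mul ?_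
      refine Finset.measurable_sum _ fun j _ => ?_
      exact ((hinv i j).comp measurable_snd).mul ((measurable_pi_apply j).comp measurable_fst)
    exact (hquad.const_mul _).exp.mul ((hdet.comp measurable_snd).pow_const _)
  have hcancel {d : ℝ} (hd : 0 < d) : d ^ (1 / 2 : ℝ) * d ^ (-(1 / 2) : ℝ) = 1 := by
    rw [← Real.rpow_add hd]
    norm_num
  have hFint : Integrable (Function.uncurry F) (volume.prod P) := by
    rw [integrable_prod_iff' hFm.aestronglyMeasurable]
    constructor
    · filter_upwards [hQ] with s hs
      exact hs.integrable_gaussian.mul_const ((Q s).det ^ (-(1 / 2) : ℝ))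
    · refine (integrable_const ((2 * π) ^ ((n : ℝ) / 2))).congr ?_
      filter_upwards [hQ] with s hs
      have hnorm (y : Fin n → ℝ) : ‖Function.uncurry F (y, s)‖ = F y s :=
        Real.norm_of_nonneg (mul_nonneg (Real.exp_pos _).le (Real.rpow_nonneg hs.det_pos.le _))
      simp_rw [hnorm, hF]
      rw [integral_mul_const, hs.integral_gaussian, mul_assoc, hcancel hs.det_pos, mul_one]
  have hGint : Integrable (fun z : (Fin n → ℝ) × Ω =>
      (F z.1 z.2 : ℂ) * Complex.exp (Complex.I * ((t ⬝ᵥ z.1 : ℝ) : ℂ))) (volume.prod P) := by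
    refine hFint.ofReal.mul_bdd (c := 1) ?_ (ae_of_all _ fun z => ?_)
    · have hc : Continuous fun y : Fin n → ℝ =>
          Complex.exp (Complex.I * ((t ⬝ᵥ y : ℝ) : ℂ)) := by fun_prop
      exact (hc.measurable.comp measurable_fst).aestronglyMeasurable
    · rw [mul_comm, Complex.norm_exp_ofReal_mul_I]
  have hpi : (2 * π) ^ (-(n : ℝ) / 2) * (2 * π) ^ ((n : ℝ) / 2) = 1 := by
    rw [← Real.rpow_add (by positivity), neg_div, neg_add_cancel, Real.rpow_zero]
  calc
    _ = (((2 * π) ^ (-(n : ℝ) / 2) : ℝ) : ℂ) * ∫ y : Fin n → ℝ, ∫ s, (F y s : ℂ) *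
          Complex.exp (Complex.I * ((t ⬝ᵥ y : ℝ) : ℂ)) ∂P := by
      rw [← integral_const_mul]
      refine integral_congr_ae (ae_of_all _ fun y => ?_)
      dsimp only
      rw [integral_mul_const, integral_complex_ofReal, Complex.ofReal_mul, mul_assoc]
    _ = (((2 * π) ^ (-(n : ℝ) / 2) : ℝ) : ℂ) * ∫ s, (((2 * π) ^ ((n : ℝ) / 2) *
          rexp (-(1 / 2) * (t ⬝ᵥ Q s *ᵥ t)) : ℝ) : ℂ) ∂P := by
      rw [integral_integral_swap hGint]
      congr 1
      refine integral_congr_ae ?_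
      filter_upwards [hQ] with s hs
      simp only [hF, Complex.ofReal_mul, mul_right_comm _ (((Q s).det ^ (-(1 / 2) : ℝ) : ℝ) : ℂ)]
      rw [integral_mul_const, hs.integral_gaussian_mul_cexp, ← Complex.ofReal_mul,
        ← Complex.ofReal_mul, mul_right_comm, mul_assoc ((2 * π) ^ ((n : ℝ) / 2)),
        hcancel hs.det_pos, mul_one]
    _ = _ := by
      rw [integral_complex_ofReal, ← Complex.ofReal_mul, integral_const_mul, ← mul_assoc, hpi,
        one_mul]

end Mixture

/-- Theorem 1 of the paper, characteristic-function form: the conditionally Gaussian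
mixture density `p` has exactly the characteristic function of the α-stable network
scaling limit with additive Gaussian observation noise. -/
theorem stable_mixture_density_charfun (n L : ℕ) (hn : 0 < n) (hL : 0 < L)
    (α σ ν : ℝ) (hα₀ : 0 < α) (hα₂ : α < 2) (hσ : 0 < σ) (hν : 0 < ν)
    (q : Fin L → ℝ) (hq : ∀ ℓ, 0 ≤ q ℓ)
    (τ : Fin L → Fin n → ℝ) (hτ : ∀ ℓ j, τ ℓ j = 1 ∨ τ ℓ j = -1)
    (μ : Measure ℝ) [IsProbabilityMeasure μ] (hsupp : μ (Set.Iio 0) = 0)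
    (hLap : ∀ l : ℝ, 0 ≤ l → ∫ t, Real.exp (-l * t) ∂μ = Real.exp (-l ^ (α / 2)))
    (Q : (Fin L → ℝ) → Matrix (Fin n) (Fin n) ℝ)
    (hQ : ∀ s, Q s = σ ^ 2 • (1 : Matrix (Fin n) (Fin n) ℝ) +
      ν • ∑ ℓ : Fin L, (s ℓ * q ℓ ^ ((2 : ℝ) / α)) •
        Matrix.of (fun i j : Fin n => τ ℓ i * τ ℓ j))
    (p : (Fin n → ℝ) → ℝ)
    (hp : ∀ y, p y = (2 * π) ^ (-(n : ℝ) / 2) *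
      ∫ s in {s : Fin L → ℝ | ∀ ℓ, 0 < s ℓ},
        Real.exp (-(1 / 2) * (y ⬝ᵥ (Q s)⁻¹ *ᵥ y)) * (Q s).det ^ (-(1 / 2) : ℝ)
          ∂(Measure.pi fun _ : Fin L => μ))
    (t : Fin n → ℝ) :
    (∫ y : Fin n → ℝ,
        (p y : ℂ) * Complex.exp (Complex.I * ((∑ j, t j * y j : ℝ) : ℂ))) =
      ((Real.exp (-(1 / 2) * σ ^ 2 * ∑ j, t j ^ 2 -
        (ν / 2) ^ (α / 2) * ∑ ℓ, q ℓ * |∑ j, t j * τ ℓ j| ^ α) : ℝ) : ℂ) := by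
  have hpos : ∀ᵐ s ∂(Measure.pi fun _ : Fin L => μ), ∀ ℓ, 0 < s ℓ :=
    ae_all_iff.mpr fun ℓ => Measure.tendsto_eval_ae_ae.eventually
      (ae_pos_of_laplace_eq_exp_neg_rpow (half_pos hα₀) hsupp hLap)
  have hrestrict : (Measure.pi fun _ : Fin L => μ).restrict {s : Fin L → ℝ | ∀ ℓ, 0 < s ℓ} =
      Measure.pi fun _ : Fin L => μ := Measure.restrict_eq_self_of_ae_mem hpos
  have hr (ℓ : Fin L) : 0 ≤ q ℓ ^ ((2 : ℝ) / α) := Real.rpow_nonneg (hq ℓ) _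
  have hQpos : ∀ᵐ s ∂(Measure.pi fun _ : Fin L => μ), (Q s).PosDef := by
    filter_upwards [hpos] with s hs
    rw [hQ]
    exact posDef_smul_one_add_sum_rankOne hσ hν (fun ℓ => mul_nonneg (hs ℓ).le (hr ℓ)) τ
  have hQm (i j : Fin n) : Measurable fun s => Q s i j := by
    simp only [hQ, Matrix.add_apply, Matrix.smul_apply, Matrix.sum_apply, Matrix.of_apply]
    fun_prop
  set b : Fin L → ℝ := fun ℓ => ν / 2 * (q ℓ ^ ((2 : ℝ) / α) * (∑ j, t j * τ ℓ j) ^ 2) with hb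
  have hb0 (ℓ : Fin L) : 0 ≤ b ℓ := mul_nonneg (half_pos hν).le (mul_nonneg (hr ℓ) (sq_nonneg _))
  have hbα (ℓ : Fin L) : b ℓ ^ (α / 2) =
      (ν / 2) ^ (α / 2) * (q ℓ * |∑ j, t j * τ ℓ j| ^ α) := by
    rw [hb, Real.mul_rpow (half_pos hν).le (mul_nonneg (hr ℓ) (sq_nonneg _)),
      Real.mul_rpow (hr ℓ) (sq_nonneg _), ← Real.rpow_mul (hq ℓ), ← sq_abs,
      ← Real.rpow_natCast, ← Real.rpow_mul (abs_nonneg _)]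
    have h1 : (2 : ℝ) / α * (α / 2) = 1 := by field_simp
    have h2 : ((2 : ℕ) : ℝ) * (α / 2) = α := by push_cast; ring
    rw [h1, h2, Real.rpow_one]
  have hexp (s : Fin L → ℝ) : rexp (-(1 / 2) * (t ⬝ᵥ Q s *ᵥ t)) =
      rexp (-(1 / 2) * σ ^ 2 * ∑ j, t j ^ 2) * ∏ ℓ, rexp (-b ℓ * s ℓ) := by
    rw [hQ, dotProduct_smul_one_add_sum_rankOne_mulVec, ← Real.exp_sum, ← Real.exp_add,
      mul_add, ← mul_assoc]
    congr 2
    rw [Finset.mul_sum, Finset.mul_sum]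
    refine Finset.sum_congr rfl fun ℓ _ => ?_
    simp only [hb]
    ring
  have hp' (y : Fin n → ℝ) := hp y
  simp only [hrestrict] at hp'
  simp_rw [hp']
  refine (integral_gaussianMixture_mul_cexp hQm hQpos t).trans ?_
  congr 1
  simp_rw [hexp]
  rw [integral_const_mul, integral_fintype_prod_eq_prod (fun ℓ x => rexp (-b ℓ * x))]
  simp_rw [hLap _ (hb0 _), hbα]
  rw [← Real.exp_sum, ← Real.exp_add, Finset.sum_neg_distrib, ← Finset.mul_sum, sub_eq_add_neg]
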